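/- Let G be a gyrogroup. Then L(G)′ = {L_{a₁}∘L_{a₂}∘⋯∘L_{aₙ} : aᵢ∈G and L_{aₙ}∘L_{aₙ₋₁}∘⋯∘L_{a₁} = id} is a normal subgroup of the left multiplication group LMlt(G), and L(G)′ ⊆ L(G)^# where L(G)^# = ⋂_{a∈G} L_a∘L(G) (here L_a∘L(G) = {L_a∘L_b : b∈G}). -/

import Mathlib

universe u v

/-- A gyrogroup: a groupoid `(G, +)` with a left identity `0`, left inverses `-a`,
gyroautomorphisms `gyr a b` (automorphisms of `(G, +)`) satisfying the left
gyroassociative law, and the left loop property. -/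
class Gyrogroup (G : Type u) extends Add G, Zero G, Neg G where
  /-- (G1) left identity -/
  zero_add' : ∀ a : G, 0 + a = a
  /-- (G2) left inverse -/
  neg_add' : ∀ a : G, -a + a = 0
  /-- (G3) the gyroautomorphisms, as bijections of `G` -/
  gyr : G → G → G ≃ G
  /-- (G3) each `gyr a b` preserves the operation, i.e. is an automorphism -/
  gyr_add' : ∀ a b x y : G, gyr a b (x + y) = gyr a b x + gyr a b y
  /-- (G3) left gyroassociative law -/
  add_gyr_assoc' : ∀ a b c : G, a + (b + c) = (a + b) + gyr a b c
  /-- (G4) left loop property -/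
  left_loop' : ∀ a b : G, gyr (a + b) b = gyr a b

open Gyrogroup

variable {G : Type u}

/-- A subgyrogroup: a nonempty subset closed under the operation and inverses. -/
structure IsSubgyrogroup [Gyrogroup G] (H : Set G) : Prop where
  nonempty : H.Nonempty
  add_mem : ∀ ⦃a : G⦄, a ∈ H → ∀ ⦃b : G⦄, b ∈ H → a + b ∈ H
  neg_mem : ∀ ⦃a : G⦄, a ∈ H → -a ∈ H

/-- A gyrogroup homomorphism: a map preserving the operation. -/
def IsGyroHom [Gyrogroup G] {A : Type v} [Gyrogroup A] (φ : G → A) : Prop :=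
  ∀ x y : G, φ (x + y) = φ x + φ y

/-- The kernel of a map into a gyrogroup. -/
def gyroKer [Gyrogroup G] {A : Type v} [Gyrogroup A] (φ : G → A) : Set G :=
  {x : G | φ x = 0}

/-- A normal subgyrogroup: the kernel of some gyrogroup homomorphism from `G`. -/
def IsNormalSubgyrogroup [Gyrogroup G] (N : Set G) : Prop :=
  IsSubgyrogroup N ∧ ∃ (A : Type u) (instA : Gyrogroup A) (φ : G → A),
    @IsGyroHom G _ A instA φ ∧ N = @gyroKer G _ A instA φ

/-- The gyrocommutator `[a, b] = -(a + b) + gyr a b (b + a)`. -/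
def gyroCommutator [Gyrogroup G] (a b : G) : G :=
  -(a + b) + gyr a b (b + a)

/-- The set of all gyrocommutators of `G`. -/
def gyroCommutatorSet (G : Type u) [Gyrogroup G] : Set G :=
  {x : G | ∃ a b : G, x = gyroCommutator a b}

/-- `K` is the commutator subgyrogroup `G'` of `G`: the smallest subgyrogroup
containing all commutators. -/
def IsCommutatorSubgyrogroup [Gyrogroup G] (K : Set G) : Prop :=
  IsSubgyrogroup K ∧ gyroCommutatorSet G ⊆ K ∧
    ∀ H : Set G, IsSubgyrogroup H → gyroCommutatorSet G ⊆ H → K ⊆ H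

/-- `K` is the normal closure `⟨⟨A⟩⟩` of `A`: the smallest normal subgyrogroup
containing `A`. -/
def IsGyroNormalClosure [Gyrogroup G] (A K : Set G) : Prop :=
  IsNormalSubgyrogroup K ∧ A ⊆ K ∧
    ∀ N : Set G, IsNormalSubgyrogroup N → A ⊆ N → K ⊆ N

/-- The left coset `a ⊕ H`. -/
def lcoset [Gyrogroup G] (a : G) (H : Set G) : Set G := (a + ·) '' H

/-- The right coset `H ⊕ a`. -/
def rcoset [Gyrogroup G] (H : Set G) (a : G) : Set G := (· + a) '' H

/-- A gyrogroup is gyrocommutative if `a + b = gyr a b (b + a)` for all `a, b`. -/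
def IsGyrocommutative (G : Type u) [Gyrogroup G] : Prop :=
  ∀ a b : G, a + b = gyr a b (b + a)

/-- An L-subgyrogroup: a subgyrogroup with `gyr a h (H) = H` for all `a ∈ G`, `h ∈ H`. -/
def IsLSubgyrogroup [Gyrogroup G] (H : Set G) : Prop :=
  IsSubgyrogroup H ∧ ∀ a : G, ∀ h ∈ H, ⇑(gyr a h) '' H = H

/-- A subgroup of a gyrogroup: a subgyrogroup that forms a group under the gyrogroup
operation (equivalently, on which the operation is associative; together with the
closure properties and the identity and inverses inherited from `G`, this makes it
a group). -/
def IsSubgroupOfGyrogroup [Gyrogroup G] (H : Set G) : Prop :=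
  IsSubgyrogroup H ∧ ∀ a ∈ H, ∀ b ∈ H, ∀ c ∈ H, a + (b + c) = (a + b) + c

/-- The left nucleus of `G`. -/
def leftNucleus (G : Type u) [Gyrogroup G] : Set G :=
  {a : G | ∀ b c : G, a + (b + c) = (a + b) + c}

/-- The middle nucleus of `G`. -/
def middleNucleus (G : Type u) [Gyrogroup G] : Set G :=
  {b : G | ∀ a c : G, a + (b + c) = (a + b) + c}

/-- The right nucleus of `G`. -/
def rightNucleus (G : Type u) [Gyrogroup G] : Set G :=
  {c : G | ∀ a b : G, a + (b + c) = (a + b) + c}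

/-- `L(G)`: the set of left gyrotranslations of `G`, viewed as permutations of `G`.
A permutation `σ` is a left gyrotranslation when `σ x = a + x` for some fixed `a`. -/
def LSet (G : Type u) [Gyrogroup G] : Set (Equiv.Perm G) :=
  {σ : Equiv.Perm G | ∃ a : G, ∀ x : G, σ x = a + x}

/-- `L(H)` for a subset `H ⊆ G`: the left gyrotranslations by elements of `H`. -/
def LSetOf [Gyrogroup G] (H : Set G) : Set (Equiv.Perm G) :=
  {σ : Equiv.Perm G | ∃ a ∈ H, ∀ x : G, σ x = a + x}

/-- The left multiplication group `LMlt(G)`: the subgroup of `Sym(G)` generated by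
the left gyrotranslations. -/
def LMlt (G : Type u) [Gyrogroup G] : Subgroup (Equiv.Perm G) :=
  Subgroup.closure (LSet G)

/-- `L(G)'`: the set of products `L_{a₁} ∘ ⋯ ∘ L_{aₙ}` of left gyrotranslations whose
reversed product `L_{aₙ} ∘ ⋯ ∘ L_{a₁}` is the identity. -/
def LPrime (G : Type u) [Gyrogroup G] : Set (Equiv.Perm G) :=
  {σ : Equiv.Perm G | ∃ l : List (Equiv.Perm G),
    (∀ τ ∈ l, τ ∈ LSet G) ∧ σ = l.prod ∧ l.reverse.prod = 1}

/-- `L(G)^# = ⋂_{a ∈ G} L_a ∘ L(G)`. -/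
def LSharp (G : Type u) [Gyrogroup G] : Set (Equiv.Perm G) :=
  {σ : Equiv.Perm G | ∀ ρ ∈ LSet G, ∃ τ ∈ LSet G, σ = ρ * τ}

/-- The radical of `G`: elements whose left gyrotranslation lies in `L(G)'`. -/
def gyroRadical (G : Type u) [Gyrogroup G] : Set G :=
  {a : G | ∃ σ ∈ LPrime G, ∀ x : G, σ x = a + x}

/-- `X` is a normal subgroup of the subgroup `Γ` (as a subset of the ambient group). -/
def IsNormalSubgroupIn {M : Type v} [Group M] (Γ : Subgroup M) (X : Set M) : Prop :=
  X ⊆ (Γ : Set M) ∧ (1 : M) ∈ X ∧ (∀ σ ∈ X, σ⁻¹ ∈ X) ∧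
    (∀ σ ∈ X, ∀ τ ∈ X, σ * τ ∈ X) ∧ ∀ γ ∈ Γ, ∀ σ ∈ X, γ * σ * γ⁻¹ ∈ X

/-- The coaddition `a ⊞ b = a + gyr a (-b) b`. -/
def gyroCoadd [Gyrogroup G] (a b : G) : G := a + gyr a (-b) b

/-- Natural-number multiples: `0 • a = 0`, `(m+1) • a = a + m • a`. -/
def gyroNsmul [Gyrogroup G] : ℕ → G → G
  | 0, _ => 0
  | n + 1, a => a + gyroNsmul n a

/-- The index `[G : H]`: the number of left cosets of `H` in `G`. -/
noncomputable def gyroIndex [Gyrogroup G] (H : Set G) : ℕ :=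
  Set.ncard {S : Set G | ∃ a : G, S = lcoset a H}

namespace Gyrogroup

theorem add_left_cancel_of_eq [Gyrogroup G] {a x y : G} (h : a + x = a + y) : x = y := by
  have h' : -a + (a + x) = -a + (a + y) := by rw [h]
  rw [add_gyr_assoc', add_gyr_assoc' (-a) a y, neg_add', zero_add', zero_add'] at h'
  exact (gyr (-a) a).injective h'

theorem gyr_zero_left [Gyrogroup G] (a x : G) : gyr 0 a x = x := by
  have h := add_gyr_assoc' 0 a x
  rw [zero_add', zero_add'] at h
  exact (add_left_cancel_of_eq h).symm

theorem neg_add_cancel_left' [Gyrogroup G] (a x : G) : -a + (a + x) = x := by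
  have h := left_loop' (-a) a
  rw [neg_add'] at h
  rw [add_gyr_assoc', neg_add', zero_add', ← h, gyr_zero_left]

theorem gyr_gyr_cancel [Gyrogroup G] (a b x : G) : gyr a (b + a) (gyr b a x) = x := by
  have h := add_gyr_assoc' (-b) (b + a) (gyr b a x)
  have hloop := left_loop' (-b) (b + a)
  rw [neg_add_cancel_left'] at hloop
  rw [← add_gyr_assoc' b a x, neg_add_cancel_left', neg_add_cancel_left', ← hloop] at h
  exact (add_left_cancel_of_eq h).symm

/-- The left Bol identity. -/
theorem left_bol [Gyrogroup G] (a b x : G) : a + (b + (a + x)) = (a + (b + a)) + x := by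
  rw [add_gyr_assoc' b a x, add_gyr_assoc' a (b + a), gyr_gyr_cancel]

end Gyrogroup

theorem one_mem_LSet [Gyrogroup G] : (1 : Equiv.Perm G) ∈ LSet G :=
  ⟨0, fun x => (zero_add' x).symm⟩

theorem inv_mem_LSet [Gyrogroup G] {σ : Equiv.Perm G} (hσ : σ ∈ LSet G) : σ⁻¹ ∈ LSet G := by
  obtain ⟨a, ha⟩ := hσ
  refine ⟨-a, fun x => ?_⟩
  obtain ⟨y, rfl⟩ := σ.surjective x
  rw [Equiv.Perm.inv_eq_iff_eq, ha, ha, neg_add_cancel_left']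

theorem mul_mul_mem_LSet [Gyrogroup G] {σ τ : Equiv.Perm G} (hσ : σ ∈ LSet G)
    (hτ : τ ∈ LSet G) : σ * τ * σ ∈ LSet G := by
  obtain ⟨a, ha⟩ := hσ
  obtain ⟨b, hb⟩ := hτ
  refine ⟨a + (b + a), fun x => ?_⟩
  rw [Equiv.Perm.mul_apply, Equiv.Perm.mul_apply, ha, hb, ha, left_bol]

theorem prod_mul_mul_reverse_prod_mem_LSet [Gyrogroup G] {ρ : Equiv.Perm G} (hρ : ρ ∈ LSet G)
    (l : List (Equiv.Perm G)) (hl : ∀ τ ∈ l, τ ∈ LSet G) :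
    l.prod * ρ * l.reverse.prod ∈ LSet G := by
  induction l with
  | nil => simpa using hρ
  | cons σ l ih =>
    have h := mul_mul_mem_LSet (hl σ (by simp)) (ih fun τ hτ => hl τ (by simp [hτ]))
    simpa [mul_assoc] using h

theorem LPrime_mul_mem_LSet [Gyrogroup G] {σ ρ : Equiv.Perm G} (hσ : σ ∈ LPrime G)
    (hρ : ρ ∈ LSet G) : σ * ρ ∈ LSet G := by
  obtain ⟨l, hl, rfl, h⟩ := hσ
  simpa [h] using prod_mul_mul_reverse_prod_mem_LSet hρ l hl

theorem LPrime_subset_LMlt [Gyrogroup G] : LPrime G ⊆ (LMlt G : Set (Equiv.Perm G)) := by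
  rintro _ ⟨l, hl, rfl, -⟩
  exact Subgroup.list_prod_mem _ fun τ hτ => Subgroup.subset_closure (hl τ hτ)

theorem one_mem_LPrime [Gyrogroup G] : (1 : Equiv.Perm G) ∈ LPrime G :=
  ⟨[], by simp⟩

theorem inv_mem_LPrime [Gyrogroup G] {σ : Equiv.Perm G} (hσ : σ ∈ LPrime G) :
    σ⁻¹ ∈ LPrime G := by
  obtain ⟨l, hl, rfl, h⟩ := hσ
  refine ⟨(l.map (·⁻¹)).reverse, fun τ hτ => ?_, List.prod_inv_reverse l, ?_⟩
  · obtain ⟨ρ, hρ, rfl⟩ := List.mem_map.1 (List.mem_reverse.1 hτ)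
    exact inv_mem_LSet (hl ρ hρ)
  · rw [← List.map_reverse, ← List.prod_inv_reverse, h, inv_one]

theorem mul_mem_LPrime [Gyrogroup G] {σ τ : Equiv.Perm G} (hσ : σ ∈ LPrime G)
    (hτ : τ ∈ LPrime G) : σ * τ ∈ LPrime G := by
  obtain ⟨l, hl, rfl, h⟩ := hσ
  obtain ⟨m, hm, rfl, h'⟩ := hτ
  refine ⟨l ++ m, fun ρ hρ => ?_, List.prod_append.symm, by simp [h, h']⟩
  exact (List.mem_append.1 hρ).elim (hl ρ) (hm ρ)

theorem conj_mem_LPrime_of_mem_LSet [Gyrogroup G] {γ σ : Equiv.Perm G} (hγ : γ ∈ LSet G)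
    (hσ : σ ∈ LPrime G) : γ * σ * γ⁻¹ ∈ LPrime G := by
  obtain ⟨l, hl, rfl, h⟩ := hσ
  refine ⟨γ :: (l ++ [γ⁻¹]), fun τ hτ => ?_, by simp [mul_assoc], by simp [h]⟩
  simp only [List.mem_cons, List.mem_append, List.not_mem_nil, or_false] at hτ
  rcases hτ with rfl | hτ | rfl
  exacts [hγ, hl τ hτ, inv_mem_LSet hγ]

theorem conj_mem_LPrime [Gyrogroup G] {γ : Equiv.Perm G} (hγ : γ ∈ LMlt G) :
    ∀ σ ∈ LPrime G, γ * σ * γ⁻¹ ∈ LPrime G := by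
  induction hγ using Subgroup.closure_induction'' with
  | mem γ hγ => exact fun σ hσ => conj_mem_LPrime_of_mem_LSet hγ hσ
  | inv_mem γ hγ => exact fun σ hσ => conj_mem_LPrime_of_mem_LSet (inv_mem_LSet hγ) hσ
  | one => simp
  | mul γ δ _ _ ihγ ihδ =>
    intro σ hσ
    simpa [mul_assoc] using ihγ _ (ihδ σ hσ)

theorem LPrime_subset_LSharp [Gyrogroup G] : LPrime G ⊆ LSharp G := fun σ hσ ρ hρ =>
  ⟨ρ⁻¹ * σ, by simpa using inv_mem_LSet (LPrime_mul_mem_LSet (inv_mem_LPrime hσ) hρ), by simp⟩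

/-- `L(G)'` is a normal subgroup of `LMlt(G)`, and `L(G)' ⊆ L(G)^#`. -/
theorem LPrime_normal_in_LMlt_and_subset_LSharp (G : Type u) [Gyrogroup G] :
    IsNormalSubgroupIn (LMlt G) (LPrime G) ∧ LPrime G ⊆ LSharp G :=
  ⟨⟨LPrime_subset_LMlt, one_mem_LPrime, fun _ => inv_mem_LPrime,
    fun _ hσ _ hτ => mul_mem_LPrime hσ hτ, fun _ hγ => conj_mem_LPrime hγ⟩, LPrime_subset_LSharp⟩
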